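/- E_0^ω is strictly below E_0^{[ℤ]} in the Borel reducibility order: E_0^ω is Borel reducible to E_0^{[ℤ]}, but E_0^{[ℤ]} is not Borel reducible to E_0^ω. -/

import Mathlib

/-- The Γ-jump of an equivalence relation `E` on `X`. -/
def GammaJump (Γ : Type*) [Group Γ] {X : Type*} (E : X → X → Prop) :
    (Γ → X) → (Γ → X) → Prop :=
  fun x y => ∃ γ : Γ, ∀ α : Γ, E (x (γ⁻¹ * α)) (y α)

/-- Borel reducibility of binary relations on measurable spaces. -/
def BorelReducible {X Y : Type*} [MeasurableSpace X] [MeasurableSpace Y]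
    (E : X → X → Prop) (F : Y → Y → Prop) : Prop :=
  ∃ f : X → Y, Measurable f ∧ ∀ x x', E x x' ↔ F (f x) (f x')

/-- `E₀`: eventual agreement on `2^ω`. -/
def E0 : (ℕ → Bool) → (ℕ → Bool) → Prop :=
  fun x y => ∀ᶠ n in Filter.atTop, x n = y n

open Filter Topology Set

/-- A Borel map into Cantor space is continuous on a comeager set. -/
theorem exists_residual_continuousOn {X : Type*} [TopologicalSpace X] [MeasurableSpace X]
    [BorelSpace X] {f : X → ℕ → Bool} (hf : Measurable f) :
    ∃ C ∈ residual X, ContinuousOn f C := by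
  have hmeas (k : ℕ) (b : Bool) : MeasurableSet {x | f x k = b} :=
    (measurable_pi_iff.1 hf k) (measurableSet_singleton b)
  choose O hO hfO using fun k b => (hmeas k b).residualEq_isOpen
  refine ⟨{x | ∀ k b, f x k = b ↔ x ∈ O k b}, ?_, ?_⟩
  · refine eventually_countable_forall.2 fun k => eventually_countable_forall.2 fun b => ?_
    exact (hfO k b).mem_iff
  · refine continuousOn_pi.2 fun k x hx => ?_
    have hN : O k (f x k) ∈ 𝓝 x := (hO k _).mem_nhds ((hx k _).1 rfl)
    refine tendsto_nhds_of_eventually_eq ?_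
    filter_upwards [mem_nhdsWithin_of_mem_nhds hN, self_mem_nhdsWithin] with y hyO hyC
    exact (hyC k _).2 hyO

/-- Coordinatewise modification of a family of binary sequences by the finitely supported
binary sequences which the entries of `g` code. -/
def bitFlip {Γ : Type*} (g : Γ → ℕ) (x : Γ → ℕ → Bool) : Γ → ℕ → Bool :=
  fun i m => xor (x i m) ((g i).testBit m)

section bitFlip

variable {Γ : Type*}

theorem bitFlip_bitFlip (g : Γ → ℕ) (x : Γ → ℕ → Bool) : bitFlip g (bitFlip g x) = x := by
  funext i m
  simp [bitFlip]

theorem continuous_bitFlip : Continuous fun p : (Γ → ℕ → Bool) × (Γ → ℕ) => bitFlip p.2 p.1 := by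
  refine continuous_pi fun i => continuous_pi fun m => ?_
  have h : Continuous fun q : Bool × ℕ => xor q.1 (q.2.testBit m) := continuous_of_discreteTopology
  exact h.comp (by fun_prop : Continuous fun p : (Γ → ℕ → Bool) × (Γ → ℕ) => (p.1 i m, p.2 i))

theorem continuous_bitFlip_right (g : Γ → ℕ) : Continuous (bitFlip g) :=
  continuous_bitFlip.comp (by fun_prop : Continuous fun x : Γ → ℕ → Bool => (x, g))

theorem isOpenMap_bitFlip : IsOpenMap fun p : (Γ → ℕ → Bool) × (Γ → ℕ) => bitFlip p.2 p.1 :=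
  .of_sections fun p => ⟨fun z => (bitFlip p.2 z, p.2),
    ((continuous_bitFlip_right p.2).prodMk continuous_const).continuousAt,
    by simp [bitFlip_bitFlip], fun z => bitFlip_bitFlip _ z⟩

theorem isOpenMap_bitFlip_right (g : Γ → ℕ) : IsOpenMap (bitFlip g) :=
  .of_sections fun _ => ⟨bitFlip g, (continuous_bitFlip_right g).continuousAt,
    bitFlip_bitFlip _ _, bitFlip_bitFlip g⟩

theorem gammaJump_bitFlip [Group Γ] (g : Γ → ℕ) (x : Γ → ℕ → Bool) :
    GammaJump Γ E0 x (bitFlip g x) := by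
  refine ⟨1, fun i => ?_⟩
  filter_upwards [eventually_ge_atTop (g i)] with m hm
  have h : (g i).testBit m = false :=
    Nat.testBit_lt_two_pow (hm.trans_lt Nat.lt_two_pow_self)
  simp [bitFlip, h]

/-- The `bitFlip`-orbits are dense, even with finitely many coordinates fixed. -/
theorem exists_bitFlip_mem {F : Finset Γ} {g₀ : Γ → ℕ} {w z : Γ → ℕ → Bool}
    (h : ∀ i ∈ F, bitFlip g₀ w i = z i) {N : Set (Γ → ℕ → Bool)} (hN : IsOpen N) (hz : z ∈ N) :
    ∃ g : Γ → ℕ, (∀ i ∈ F, g i = g₀ i) ∧ bitFlip g w ∈ N := by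
  classical
  let g : ℕ → Γ → ℕ := fun M i =>
    if i ∈ F then g₀ i else Nat.ofBits fun m : Fin M => xor (w i m) (z i m)
  have hlim : Tendsto (fun M => bitFlip (g M) w) atTop (𝓝 z) := by
    refine tendsto_pi_nhds.2 fun i => tendsto_pi_nhds.2 fun m => ?_
    refine tendsto_nhds_of_eventually_eq ?_
    filter_upwards [eventually_gt_atTop m] with M hM
    by_cases hi : i ∈ F
    · rw [← h i hi]
      simp [bitFlip, g, hi]
    · simp [bitFlip, g, hi, Nat.testBit_ofBits_lt _ _ hM]
  obtain ⟨M, hM⟩ := (hlim.eventually (hN.mem_nhds hz)).exists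
  exact ⟨g M, fun i hi => by simp [g, hi], hM⟩

end bitFlip

section Localization

variable {Γ : Type*} [Countable Γ] {f : (Γ → ℕ → Bool) → ℕ → Bool}
  {C : Set (Γ → ℕ → Bool)}

/-- If `f x` and `f (bitFlip g x)` always agree eventually, then locally they agree from a fixed
place on. -/
theorem exists_uniform_tail (hf : ∀ g x, E0 (f x) (f (bitFlip g x)))
    (hC : C ∈ residual (Γ → ℕ → Bool)) (hfC : ContinuousOn f C) :
    ∃ (n : ℕ) (U : Set (Γ → ℕ → Bool)) (g₀ : Γ → ℕ) (F : Finset Γ), IsOpen U ∧ U.Nonempty ∧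
      ∀ x ∈ U, x ∈ C → ∀ g : Γ → ℕ, (∀ i ∈ F, g i = g₀ i) → bitFlip g x ∈ C →
        ∀ k ≥ n, f (bitFlip g x) k = f x k := by
  classical
  let T : (Γ → ℕ → Bool) × (Γ → ℕ) → Γ → ℕ → Bool := fun p => bitFlip p.2 p.1
  let Z : Set ((Γ → ℕ → Bool) × (Γ → ℕ)) := {p | p.1 ∈ C ∧ T p ∈ C}
  have hZ : Z ∈ residual _ :=
    inter_mem (tendsto_residual_of_isOpenMap continuous_fst isOpenMap_fst hC)
      (tendsto_residual_of_isOpenMap continuous_bitFlip isOpenMap_bitFlip hC)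
  have hf₁ : ContinuousOn (fun p => f p.1) Z :=
    hfC.comp continuous_fst.continuousOn fun _ hp => hp.1
  have hf₂ : ContinuousOn (fun p => f (T p)) Z :=
    hfC.comp continuous_bitFlip.continuousOn fun _ hp => hp.2
  let A : ℕ → Set ((Γ → ℕ → Bool) × (Γ → ℕ)) :=
    fun n => {p ∈ Z | ∀ k ≥ n, f (T p) k = f p.1 k}
  obtain ⟨t, htZ, htG, htd⟩ := mem_residual.1 hZ
  have hcover : t ⊆ ⋃ n, closure (A n) := by
    intro p hp
    obtain ⟨n, hn⟩ := eventually_atTop.1 (hf p.2 p.1)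
    exact mem_iUnion.2 ⟨n, subset_closure ⟨htZ hp, fun k hk => (hn k hk).symm⟩⟩
  obtain ⟨p, hp⟩ :=
    (htG.dense_iUnion_interior_of_closed htd (fun _ => isClosed_closure) hcover).nonempty
  obtain ⟨n, hp⟩ := mem_iUnion.1 hp
  have hA : ∀ q ∈ interior (closure (A n)), q ∈ Z → ∀ k ≥ n, f (T q) k = f q.1 k := by
    intro q hq hqZ k hk
    have hsub : Z ∩ interior (closure (A n)) ⊆ closure (A n) :=
      fun r hr => interior_subset hr.2
    refine EqOn.of_subset_closure (s := A n) (t := A n ∪ Z ∩ interior (closure (A n)))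
      (f := fun q => f (T q) k) (g := fun q => f q.1 k) (fun r hr => hr.2 k hk) ?_ ?_
      subset_union_left (union_subset subset_closure hsub) (Or.inr ⟨hqZ, hq⟩)
    · exact (continuousOn_pi.1 hf₂ k).mono (union_subset (fun r hr => hr.1) inter_subset_left)
    · exact (continuousOn_pi.1 hf₁ k).mono (union_subset (fun r hr => hr.1) inter_subset_left)
  obtain ⟨U, V, hU, hV, hpU, hpV, hUV⟩ := isOpen_prod_iff.1 isOpen_interior p.1 p.2 hp
  obtain ⟨F, u, hu, huV⟩ := isOpen_pi_iff.1 hV p.2 hpV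
  refine ⟨n, U, p.2, F, hU, ⟨p.1, hpU⟩, fun x hxU hxC g hg hgC => ?_⟩
  refine hA (x, g) (hUV ⟨hxU, huV fun i hi => ?_⟩) ⟨hxC, hgC⟩
  simpa only [hg i hi] using (hu i hi).2

/-- Locally on a comeager set, the tail of `f y` from a fixed place on depends on only finitely many
coordinates of `y`. -/
theorem exists_finite_dependence (hf : ∀ g x, E0 (f x) (f (bitFlip g x)))
    (hC : C ∈ residual (Γ → ℕ → Bool)) (hfC : ContinuousOn f C) :
    ∃ (W : Set (Γ → ℕ → Bool)) (F : Finset Γ), IsOpen W ∧ W.Nonempty ∧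
      ∀ y ∈ W, y ∈ C → ∀ y' ∈ C, (∀ i ∈ F, y i = y' i) → E0 (f y) (f y') := by
  obtain ⟨n, U, g₀, F, hU, ⟨x₀, hx₀⟩, hn⟩ := exists_uniform_tail hf hC hfC
  refine ⟨bitFlip g₀ ⁻¹' U, F, hU.preimage (continuous_bitFlip_right g₀),
    ⟨bitFlip g₀ x₀, by simpa [bitFlip_bitFlip] using hx₀⟩, fun y hyU hyC y' hyC' hyy' => ?_⟩
  refine eventually_atTop.2 ⟨n, fun k hk => ?_⟩
  have hloc : ∀ z ∈ C, ∃ N, IsOpen N ∧ z ∈ N ∧ ∀ v ∈ N, v ∈ C → f v k = f z k := by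
    intro z hz
    have h : ∀ᶠ v in 𝓝[C] z, f v k = f z k :=
      continuousOn_pi.1 hfC k z hz ((isOpen_discrete {f z k}).mem_nhds rfl)
    obtain ⟨N, hN, hzN, hNC⟩ := mem_nhdsWithin.1 h
    exact ⟨N, hN, hzN, fun v hv hvC => hNC ⟨hv, hvC⟩⟩
  obtain ⟨N, hN, hyN, hfN⟩ := hloc y hyC
  obtain ⟨N', hN', hyN', hfN'⟩ := hloc y' hyC'
  obtain ⟨g, hgF, hgN'⟩ := exists_bitFlip_mem (g₀ := g₀) (w := bitFlip g₀ y) (z := y')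
    (F := F) (by simpa [bitFlip_bitFlip] using hyy') hN' hyN'
  have hO : IsOpen (U ∩ bitFlip g₀ ⁻¹' N ∩ bitFlip g ⁻¹' N') :=
    (hU.inter (hN.preimage (continuous_bitFlip_right g₀))).inter
      (hN'.preimage (continuous_bitFlip_right g))
  have hflip (h : Γ → ℕ) : bitFlip h ⁻¹' C ∈ residual (Γ → ℕ → Bool) :=
    tendsto_residual_of_isOpenMap (continuous_bitFlip_right h) (isOpenMap_bitFlip_right h) hC
  obtain ⟨z, ⟨⟨hzU, hzN⟩, hzN'⟩, ⟨hzC, hz₀⟩, hzg⟩ :=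
    (dense_of_mem_residual (inter_mem (inter_mem hC (hflip g₀)) (hflip g))).inter_open_nonempty _ hO
      ⟨bitFlip g₀ y, ⟨hyU, by simpa [bitFlip_bitFlip] using hyN⟩, hgN'⟩
  rw [← hfN _ hzN hz₀, ← hfN' _ hzN' hzg, hn z hzU hzC g₀ (fun _ _ => rfl) hz₀ k hk,
    hn z hzU hzC g hgF hzg k hk]

end Localization

theorem E0.symm {x y : ℕ → Bool} (h : E0 x y) : E0 y x :=
  Filter.Eventually.mono h fun _ => Eq.symm

theorem E0.trans {x y z : ℕ → Bool} (h : E0 x y) (h' : E0 y z) : E0 x z := by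
  filter_upwards [h, h'] with n hn hn' using hn.trans hn'

section Merge

variable {Γ : Type*} [Group Γ]

open Classical in
/-- The family agreeing with `p.1` on `F`, with the translate of `p.2.1` on `γ⁻¹F`, and with `p.2.2`
elsewhere. -/
noncomputable def merge (F : Finset Γ) (γ : Γ)
    (p : (Γ → ℕ → Bool) × (Γ → ℕ → Bool) × (Γ → ℕ → Bool)) : Γ → ℕ → Bool :=
  fun j => if j ∈ F then p.1 j else if γ * j ∈ F then p.2.1 (γ * j) else p.2.2 j

theorem continuous_merge (F : Finset Γ) (γ : Γ) : Continuous (merge F γ) := by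
  refine continuous_pi fun j => ?_
  unfold merge
  split_ifs <;> fun_prop

theorem isOpenMap_merge {F : Finset Γ} {γ : Γ} (hγ : ∀ i ∈ F, γ * i ∉ F) :
    IsOpenMap (merge F γ) := by
  classical
  refine .of_sections fun p => ⟨fun z => (fun i => if i ∈ F then z i else p.1 i,
    fun i => if i ∈ F then z (γ⁻¹ * i) else p.2.1 i,
    fun i => if i ∈ F ∨ γ * i ∈ F then p.2.2 i else z i), ?_, ?_, ?_⟩
  · refine Continuous.continuousAt (.prodMk ?_ (.prodMk ?_ ?_)) <;>
      refine continuous_pi fun i => ?_ <;> split_ifs <;> fun_prop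
  · refine Prod.ext ?_ (Prod.ext ?_ ?_) <;> funext i
    · by_cases hi : i ∈ F <;> simp [merge, hi]
    · by_cases hi : i ∈ F
      · have h : γ⁻¹ * i ∉ F := fun h => hγ _ h (by simpa using hi)
        simp [merge, hi, h]
      · simp [hi]
    · by_cases hi : i ∈ F <;> by_cases hi' : γ * i ∈ F <;> simp [merge, hi, hi']
  · intro z
    funext j
    by_cases hj : j ∈ F <;> by_cases hj' : γ * j ∈ F <;> simp [merge, hj, hj']

theorem isOpenMap_translate (γ : Γ) :
    IsOpenMap fun (x : Γ → ℕ → Bool) (α : Γ) => x (γ⁻¹ * α) :=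
  .of_sections fun x => ⟨fun z α => z (γ * α),
    (by fun_prop : Continuous fun (z : Γ → ℕ → Bool) (α : Γ) => z (γ * α)).continuousAt, by simp, fun z => by simp⟩

/-- A Borel homomorphism from the `Γ`-jump of `E₀` to `E₀` maps a comeager set to a single
class. -/
theorem eventually_residual_E0 [Countable Γ] [Infinite Γ] {f : (Γ → ℕ → Bool) → ℕ → Bool}
    (hfm : Measurable f) (hf : ∀ x y, GammaJump Γ E0 x y → E0 (f x) (f y)) :
    ∀ᶠ p in residual ((Γ → ℕ → Bool) × (Γ → ℕ → Bool) × (Γ → ℕ → Bool)),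
      E0 (f p.1) (f p.2.1) := by
  classical
  obtain ⟨C, hC, hfC⟩ := exists_residual_continuousOn hfm
  have hflip (g : Γ → ℕ) (x) : E0 (f x) (f (bitFlip g x)) := hf _ _ (gammaJump_bitFlip g x)
  obtain ⟨W, F, hW, ⟨w, hw⟩, hWF⟩ := exists_finite_dependence hflip hC hfC
  obtain ⟨γ, hγ⟩ := Infinite.exists_notMem_finset (Finset.image₂ (fun i j => i * j⁻¹) F F)
  have hγF : ∀ i ∈ F, γ * i ∉ F := fun i hi h =>
    hγ (Finset.mem_image₂.2 ⟨γ * i, h, i, hi, by simp⟩)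
  let P := (Γ → ℕ → Bool) × (Γ → ℕ → Bool) × (Γ → ℕ → Bool)
  let S : (Γ → ℕ → Bool) → Γ → ℕ → Bool := fun x α => x (γ⁻¹ * α)
  have hS : Continuous S := by fun_prop
  -- the generic case, for a pair of points of `W`
  have hgen (p : P) (h₁ : p.1 ∈ W ∩ C) (h₂ : p.2.1 ∈ W ∩ C) (h₃ : merge F γ p ∈ C)
      (h₄ : S (merge F γ p) ∈ C) : E0 (f p.1) (f p.2.1) := by
    have e₁ : E0 (f p.1) (f (merge F γ p)) :=
      hWF _ h₁.1 h₁.2 _ h₃ fun i hi => by simp [merge, hi]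
    have e₂ : E0 (f p.2.1) (f (S (merge F γ p))) := by
      refine hWF _ h₂.1 h₂.2 _ h₄ fun i hi => ?_
      have h : γ⁻¹ * i ∉ F := fun h => hγF _ h (by simpa using hi)
      simp [S, merge, hi, h]
    exact (e₁.trans (hf _ _ ⟨γ, fun α => Eventually.of_forall fun _ => rfl⟩)).trans e₂.symm
  obtain ⟨Q, hQc, hQd⟩ := TopologicalSpace.exists_countable_dense (Γ → ℕ)
  have hmove (y : Γ → ℕ → Bool) : ∃ g ∈ Q, bitFlip g y ∈ W := by
    obtain ⟨g, -, hg⟩ := exists_bitFlip_mem (F := ∅) (g₀ := 0) (w := y) (by simp) hW hw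
    have hcont : Continuous fun g => bitFlip g y :=
      continuous_bitFlip.comp (by fun_prop : Continuous fun g : Γ → ℕ => (y, g))
    obtain ⟨q, hq, hqQ⟩ := hQd.inter_open_nonempty _ (hW.preimage hcont) ⟨g, hg⟩
    exact ⟨q, hqQ, hq⟩
  let R (g h : Γ → ℕ) (p : P) : P := (bitFlip g p.1, bitFlip h p.2.1, p.2.2)
  have hRc (g h : Γ → ℕ) : Continuous (R g h) :=
    ((continuous_bitFlip_right g).comp continuous_fst).prodMk
      (((continuous_bitFlip_right h).comp (continuous_fst.comp continuous_snd)).prodMk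
        (continuous_snd.comp continuous_snd))
  have hRR (g h : Γ → ℕ) (p : P) : R g h (R g h p) = p := by simp [R, bitFlip_bitFlip]
  have hRo (g h : Γ → ℕ) : IsOpenMap (R g h) :=
    .of_sections fun p => ⟨R g h, (hRc g h).continuousAt, hRR g h p, hRR g h⟩
  have hgood : ∀ᶠ p in residual P,
      p.1 ∈ C ∧ p.2.1 ∈ C ∧ merge F γ p ∈ C ∧ S (merge F γ p) ∈ C := by
    refine Eventually.and ?_ (.and ?_ (.and ?_ ?_))
    · exact tendsto_residual_of_isOpenMap continuous_fst isOpenMap_fst hC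
    · exact tendsto_residual_of_isOpenMap (continuous_fst.comp continuous_snd)
        (isOpenMap_fst.comp isOpenMap_snd) hC
    · exact tendsto_residual_of_isOpenMap (continuous_merge F γ) (isOpenMap_merge hγF) hC
    · exact tendsto_residual_of_isOpenMap (hS.comp (continuous_merge F γ))
        ((isOpenMap_translate γ).comp (isOpenMap_merge hγF)) hC
  have hall : ∀ᶠ p in residual P, ∀ g ∈ Q, ∀ h ∈ Q, (R g h p).1 ∈ C ∧ (R g h p).2.1 ∈ C ∧
      merge F γ (R g h p) ∈ C ∧ S (merge F γ (R g h p)) ∈ C :=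
    (eventually_countable_ball hQc).2 fun g _ => (eventually_countable_ball hQc).2 fun h _ =>
      (tendsto_residual_of_isOpenMap (hRc g h) (hRo g h)).eventually hgood
  filter_upwards [hall] with p hp
  obtain ⟨g, hg, hgW⟩ := hmove p.1
  obtain ⟨h, hh, hhW⟩ := hmove p.2.1
  obtain ⟨h₁, h₂, h₃, h₄⟩ := hp g hg h hh
  exact ((hflip g p.1).trans (hgen (R g h p) ⟨hgW, h₁⟩ ⟨hhW, h₂⟩ h₃ h₄)).trans (hflip h p.2.1).symm

/-- The classes of the `Γ`-jump of `E₀` are meager, in the form that generic points are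
inequivalent. -/
theorem eventually_residual_not_gammaJump [Countable Γ] :
    ∀ᶠ p in residual ((Γ → ℕ → Bool) × (Γ → ℕ → Bool) × (Γ → ℕ → Bool)),
      ¬ GammaJump Γ E0 p.1 p.2.1 := by
  classical
  have key (γ : Γ) (M : ℕ) :
      ∀ᶠ p in residual ((Γ → ℕ → Bool) × (Γ → ℕ → Bool) × (Γ → ℕ → Bool)),
        ∃ m ≥ M, p.1 (γ⁻¹ * 1) m ≠ p.2.1 1 m := by
    refine residual_of_dense_open ?_ ?_
    · have hU : {p : (Γ → ℕ → Bool) × (Γ → ℕ → Bool) × (Γ → ℕ → Bool) |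
          ∃ m ≥ M, p.1 (γ⁻¹ * 1) m ≠ p.2.1 1 m} =
          ⋃ m ≥ M, {p | p.1 (γ⁻¹ * 1) m ≠ p.2.1 1 m} := by ext; simp
      change IsOpen {p : (Γ → ℕ → Bool) × (Γ → ℕ → Bool) × (Γ → ℕ → Bool) |
          ∃ m ≥ M, p.1 (γ⁻¹ * 1) m ≠ p.2.1 1 m}
      rw [hU]
      exact isOpen_biUnion fun m _ => isOpen_ne_fun (by fun_prop) (by fun_prop)
    · intro p
      let q : ℕ → (Γ → ℕ → Bool) × (Γ → ℕ → Bool) × (Γ → ℕ → Bool) := fun m =>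
        (p.1, fun i k => if k = m then !p.1 (γ⁻¹ * 1) m else p.2.1 i k, p.2.2)
      have hq : Tendsto q atTop (𝓝 p) := by
        refine tendsto_const_nhds.prodMk_nhds (Tendsto.prodMk_nhds ?_ tendsto_const_nhds)
        refine tendsto_pi_nhds.2 fun i => tendsto_pi_nhds.2 fun k => ?_
        refine tendsto_nhds_of_eventually_eq ?_
        filter_upwards [eventually_gt_atTop k] with m hm
        simp [hm.ne]
      refine mem_closure_of_tendsto hq ?_
      filter_upwards [eventually_ge_atTop M] with m hm
      exact ⟨m, hm, by simp [q]⟩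
  filter_upwards [eventually_countable_forall.2 fun γ => eventually_countable_forall.2 (key γ)]
    with p hp
  rintro ⟨γ, hγ⟩
  obtain ⟨M, hM⟩ := eventually_atTop.1 (hγ 1)
  obtain ⟨m, hm, hne⟩ := hp γ M
  exact hne (hM m hm)

/-- For a countably infinite group `Γ`, the `Γ`-jump of `E₀` is not Borel reducible to `E₀^ω`. -/
theorem not_borelReducible_gammaJump_E0 [Countable Γ] [Infinite Γ] :
    ¬ BorelReducible (GammaJump Γ E0) (fun x y : ℕ → ℕ → Bool => ∀ n, E0 (x n) (y n)) := by
  rintro ⟨f, hfm, hf⟩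
  have h : ∀ᶠ p in residual ((Γ → ℕ → Bool) × (Γ → ℕ → Bool) × (Γ → ℕ → Bool)),
      ∀ n, E0 (f p.1 n) (f p.2.1 n) :=
    eventually_countable_forall.2 fun n =>
      eventually_residual_E0 (f := fun x => f x n) (measurable_pi_iff.1 hfm n)
        fun x y hxy => (hf x y).1 hxy n
  obtain ⟨p, hp, hp'⟩ := (dense_of_mem_residual
    (h.and eventually_residual_not_gammaJump)).nonempty
  exact hp' ((hf _ _).2 hp)

end Merge

theorem not_E0_const {a b : Bool} (hab : a ≠ b) : ¬ E0 (fun _ => a) (fun _ => b) := by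
  simpa [E0, hab] using fun n : ℕ => ⟨n, le_rfl⟩

/-- `E₀^ω` is Borel reducible to the `ℤ`-jump of `E₀`. -/
theorem borelReducible_E0_omega_zJump :
    BorelReducible (fun x y : ℕ → ℕ → Bool => ∀ n, E0 (x n) (y n))
      (GammaJump (Multiplicative ℤ) E0) := by
  let e : (ℕ → ℕ → Bool) → ℤ → ℕ → Bool := fun x k =>
    if k < 0 then fun _ => false else if k = 0 then fun _ => true else x (k.toNat - 1)
  refine ⟨fun x α => e x α.toAdd, ?_, fun x y => ⟨fun h => ⟨1, fun α => ?_⟩, ?_⟩⟩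
  · refine measurable_pi_iff.2 fun α => ?_
    dsimp only [e]
    split_ifs <;> fun_prop
  · dsimp only [e]
    rw [inv_one, one_mul]
    split_ifs
    · exact Eventually.of_forall fun _ => rfl
    · exact Eventually.of_forall fun _ => rfl
    · exact h _
  · rintro ⟨γ, hγ⟩
    have hγ' (k : ℤ) : E0 (e x (-γ.toAdd + k)) (e y k) := hγ (Multiplicative.ofAdd k)
    have h0 : γ.toAdd = 0 := by
      rcases lt_trichotomy γ.toAdd 0 with h | h | h
      · have := hγ' γ.toAdd
        simp only [e, neg_add_cancel, lt_irrefl, if_false, if_true, h] at this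
        exact (not_E0_const (by simp) this).elim
      · exact h
      · have := hγ' 0
        simp only [e, add_zero, lt_irrefl, if_false, if_true, Left.neg_neg_iff, h] at this
        exact (not_E0_const (by simp) this).elim
    intro n
    have h := hγ' (n + 1)
    have h₁ : ¬ ((n : ℤ) + 1 < 0) := by lia
    have h₂ : (n : ℤ) + 1 ≠ 0 := by lia
    have h₃ : ((n : ℤ) + 1).toNat - 1 = n := by lia
    simpa only [e, h0, neg_zero, zero_add, if_neg h₁, if_neg h₂, h₃] using h

/-- `E₀^ω <_B E₀^{[ℤ]}`: the countable power of `E₀` is Borel reducible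
to the ℤ-jump of `E₀`, but not conversely. -/
theorem e0_omega_strictly_below_e0_zJump :
    BorelReducible (fun x y : ℕ → ℕ → Bool => ∀ n, E0 (x n) (y n))
        (GammaJump (Multiplicative ℤ) E0) ∧
      ¬ BorelReducible (GammaJump (Multiplicative ℤ) E0)
        (fun x y : ℕ → ℕ → Bool => ∀ n, E0 (x n) (y n)) :=
  ⟨borelReducible_E0_omega_zJump, not_borelReducible_gammaJump_E0⟩
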